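/- For every k ≥ 1 and every t ∈ {1,…,k}, the pattern sets A_{k,t} and B_k are shape-Wilf-equivalent. (This states that the partially ordered pattern of length k whose poset has one element, labeled t, above all the others is shape-Wilf-equivalent to the partially ordered pattern whose poset has the element labeled k below all the others.) -/

import Mathlib

/-- A pattern is a permutation of `Fin k` for some `k : ℕ` (a permutation of length `k`,
written 0-indexed). -/
def Pattern : Type := Σ k : ℕ, Equiv.Perm (Fin k)

/-- Build a pattern from an explicit vector of values (0-indexed one-line notation). -/
noncomputable def mkPattern {k : ℕ} (v : Fin k → Fin k) (h : Function.Bijective v := by decide) : Pattern :=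
  ⟨k, Equiv.ofBijective v h⟩

/-- The permutation `π` of length `n` contains an occurrence of the pattern `p`:
there are indices `i₁ < ⋯ < i_k` (given by a strictly monotone `f`) such that
`π (f a) < π (f b) ↔ p a < p b` for all `a b`. -/
def PermContains {n : ℕ} (π : Equiv.Perm (Fin n)) (p : Pattern) : Prop :=
  ∃ f : Fin p.1 → Fin n, StrictMono f ∧
    ∀ a b : Fin p.1, π (f a) < π (f b) ↔ p.2 a < p.2 b

/-- `π` avoids every pattern in the set `S`. -/
def AvoidsSet {n : ℕ} (π : Equiv.Perm (Fin n)) (S : Set Pattern) : Prop :=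
  ∀ p ∈ S, ¬ PermContains π p

/-- Two sets of patterns are Wilf-equivalent: for every `n ≥ 1`, the number of
permutations of length `n` avoiding every pattern of `S1` equals the number of
permutations of length `n` avoiding every pattern of `S2`. -/
def WilfEquiv (S1 S2 : Set Pattern) : Prop :=
  ∀ n : ℕ, 1 ≤ n →
    Nat.card {π : Equiv.Perm (Fin n) // AvoidsSet π S1} =
    Nat.card {π : Equiv.Perm (Fin n) // AvoidsSet π S2}

/-- A Ferrers board on `[n] × [n]`: a downward-closed set of cells `(column, row)`
(0-indexed). -/
structure FerrersBoard (n : ℕ) where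
  cells : Set (Fin n × Fin n)
  downward_closed : ∀ ⦃i j i' j' : Fin n⦄, (i, j) ∈ cells → i' ≤ i → j' ≤ j → (i', j') ∈ cells

/-- `σ` is a filling of the Ferrers board `F`: each rook `(i, σ i)` lies on the board. -/
def IsFilling {n : ℕ} (F : FerrersBoard n) (σ : Equiv.Perm (Fin n)) : Prop :=
  ∀ i : Fin n, (i, σ i) ∈ F.cells

/-- The filling `σ` of `F` contains an occurrence of the pattern `p`: there are
columns `f 0 < f 1 < ⋯` whose rooks are order-isomorphic to `p`, and the whole
rectangle spanned by the occurrence lies in `F` (equivalently, by downward closure,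
the top-right corner cell lies in `F`). -/
def FillingContains {n : ℕ} (F : FerrersBoard n) (σ : Equiv.Perm (Fin n)) (p : Pattern) : Prop :=
  ∃ f : Fin p.1 → Fin n, StrictMono f ∧
    (∀ a b : Fin p.1, σ (f a) < σ (f b) ↔ p.2 a < p.2 b) ∧
    (∀ a b : Fin p.1, (f a, σ (f b)) ∈ F.cells)

/-- The filling `σ` of `F` avoids every pattern in the set `S`. -/
def FillingAvoidsSet {n : ℕ} (F : FerrersBoard n) (σ : Equiv.Perm (Fin n)) (S : Set Pattern) : Prop :=
  ∀ p ∈ S, ¬ FillingContains F σ p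

/-- Two sets of patterns are shape-Wilf-equivalent: for every `n ≥ 1` and every
Ferrers board `F` on `[n] × [n]`, the number of fillings of `F` avoiding every
pattern of `S1` equals the number of fillings of `F` avoiding every pattern of `S2`. -/
def ShapeWilfEquiv (S1 S2 : Set Pattern) : Prop :=
  ∀ n : ℕ, 1 ≤ n → ∀ F : FerrersBoard n,
    Nat.card {σ : Equiv.Perm (Fin n) // IsFilling F σ ∧ FillingAvoidsSet F σ S1} =
    Nat.card {σ : Equiv.Perm (Fin n) // IsFilling F σ ∧ FillingAvoidsSet F σ S2}

/-- `Aset k t` is the set of all patterns of length `k` whose maximum value occurs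
at position `t` (avoiding all of them is avoiding the POP with element `t` above
all other, mutually incomparable, elements). -/
def Aset (k : ℕ) (t : Fin k) : Set Pattern :=
  {r | ∃ σ : Equiv.Perm (Fin k), (∀ a : Fin k, σ a ≤ σ t) ∧ r = ⟨k, σ⟩}

/-- `Bset k hk` is the set of all patterns of length `k` whose minimum value occurs
at the last position (avoiding all of them is avoiding the POP with the last element
below all other, mutually incomparable, elements). -/
def Bset (k : ℕ) (hk : 1 ≤ k) : Set Pattern :=
  {r | ∃ σ : Equiv.Perm (Fin k),
    (∀ a : Fin k, σ ⟨k - 1, Nat.sub_lt hk Nat.one_pos⟩ ≤ σ a) ∧ r = ⟨k, σ⟩}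

/-- The permutation of `Fin (n + 1)` sending the last element to `c` and acting on the others
like `τ`, order-preservingly relabelled. -/
def insertLast {n : ℕ} (c : Fin (n + 1)) (τ : Equiv.Perm (Fin n)) : Equiv.Perm (Fin (n + 1)) :=
  ((finSuccEquiv' (Fin.last n)).trans (Equiv.optionCongr τ)).trans (finSuccEquiv' c).symm

@[simp] theorem insertLast_last {n : ℕ} (c : Fin (n + 1)) (τ : Equiv.Perm (Fin n)) :
    insertLast c τ (Fin.last n) = c := by
  simp [insertLast]

@[simp] theorem insertLast_castSucc {n : ℕ} (c : Fin (n + 1)) (τ : Equiv.Perm (Fin n))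
    (u : Fin n) : insertLast c τ u.castSucc = c.succAbove (τ u) := by
  rw [← Fin.succAbove_last_apply]
  simp only [insertLast, Equiv.trans_apply, finSuccEquiv'_succAbove]
  simp

theorem insertLast_bijective (n : ℕ) :
    Function.Bijective (fun p : Fin (n + 1) × Equiv.Perm (Fin n) => insertLast p.1 p.2) := by
  rw [Fintype.bijective_iff_injective_and_card]
  constructor
  · rintro ⟨c, τ⟩ ⟨d, ρ⟩ h
    have hcd : c = d := by simpa using congrArg (fun s => s (Fin.last n)) h
    subst hcd
    refine Prod.ext rfl (Equiv.ext fun u => ?_)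
    simpa using congrArg (fun s => s u.castSucc) h
  · simp [Fintype.card_perm, Nat.factorial_succ]

/-- `τ` places a rook in each row `v`, within the first `w v` columns, and no row `v` has both
`a` lower rooks to the left and `b` lower rooks to the right among its first `w v` columns. -/
def IsBounded {n : ℕ} (w : Fin n → ℕ) (a b : ℕ) (τ : Equiv.Perm (Fin n)) : Prop :=
  ∀ v, (τ v : ℕ) < w v ∧
    ¬(a ≤ (Finset.univ.filter fun u => u < v ∧ τ u < τ v ∧ (τ u : ℕ) < w v).card ∧
      b ≤ (Finset.univ.filter fun u => u < v ∧ τ v < τ u ∧ (τ u : ℕ) < w v).card)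

theorem card_filter_map_perm {n : ℕ} (τ : Equiv.Perm (Fin n)) (p : Fin n → Prop)
    [DecidablePred p] :
    (Finset.univ.filter fun u => p (τ u)).card = (Finset.univ.filter p).card := by
  refine Finset.card_bij' (fun u _ => τ u) (fun x _ => τ.symm x) ?_ ?_ ?_ ?_ <;> simp

theorem card_filter_fin_val {n : ℕ} (p : ℕ → Prop) [DecidablePred p] :
    (Finset.univ.filter fun x : Fin n => p x).card = ((Finset.range n).filter p).card := by
  refine Finset.card_bij (fun x _ => (x : ℕ)) ?_ ?_ ?_
  · intro x hx
    simpa using hx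
  · intro x _ y _ h
    exact Fin.ext h
  · intro x hx
    simp only [Finset.mem_filter, Finset.mem_range] at hx
    exact ⟨⟨x, hx.1⟩, by simpa using hx.2, rfl⟩

theorem card_filter_castSucc {n : ℕ} (v : Fin n) (p : Fin (n + 1) → Prop) (q : Fin n → Prop)
    [DecidablePred p] [DecidablePred q] (h : ∀ u, p u.castSucc ↔ q u) :
    (Finset.univ.filter fun u => u < v.castSucc ∧ p u).card =
      (Finset.univ.filter fun u => u < v ∧ q u).card := by
  rw [← Finset.card_map (s := Finset.univ.filter fun u => u < v ∧ q u) Fin.castSuccEmb]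
  congr 1
  ext u
  refine Fin.lastCases ?_ (fun u => ?_) u
  · have hne : ∀ a : Fin n, (a : ℕ) ≠ n := fun a => a.isLt.ne
    simp [Fin.ext_iff, (Fin.castSucc_lt_last v).not_gt, hne]
  · simp [h]

theorem succAbove_lt_iff_lt_pred {n : ℕ} (c : Fin (n + 1)) (x : Fin n) (m : ℕ)
    (hc : (c : ℕ) < m) : (c.succAbove x : ℕ) < m ↔ (x : ℕ) < m - 1 := by
  rw [Fin.succAbove]
  split_ifs with h
  · rw [Fin.lt_def] at h
    simp only [Fin.val_castSucc] at h ⊢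
    omega
  · rw [Fin.lt_def] at h
    simp only [Fin.val_castSucc, Fin.val_succ] at h ⊢
    omega

theorem isBounded_insertLast {n : ℕ} {w : Fin (n + 1) → ℕ} (hw : Antitone w)
    (hn : ∀ v, w v ≤ n + 1) (a b : ℕ) (c : Fin (n + 1)) (τ : Equiv.Perm (Fin n)) :
    IsBounded w a b (insertLast c τ) ↔
      ((c : ℕ) < w (Fin.last n) ∧ ¬(a ≤ c ∧ c + b < w (Fin.last n))) ∧
        IsBounded (fun u => w u.castSucc - 1) a b τ := by
  have key : ∀ (p : Fin (n + 1) → Prop) [DecidablePred p], ¬ p c →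
      (Finset.univ.filter fun u => u < Fin.last n ∧ p (insertLast c τ u)).card =
        (Finset.univ.filter p).card := by
    intro p _ hp
    rw [← card_filter_map_perm (insertLast c τ) p]
    congr 1
    ext u
    refine Fin.lastCases ?_ (fun u => ?_) u
    · simp [hp]
    · simp [Fin.castSucc_lt_last]
  unfold IsBounded
  rw [Fin.forall_fin_succ', and_comm]
  simp only [insertLast_last]
  rw [key (fun x => x < c ∧ (x : ℕ) < w (Fin.last n)) (by simp),
    key (fun x => c < x ∧ (x : ℕ) < w (Fin.last n)) (by simp)]
  have hW := hn (Fin.last n)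
  by_cases hc : (c : ℕ) < w (Fin.last n)
  swap
  · simp [hc]
  refine and_congr (and_congr_right fun _ => not_congr (and_congr ?_ ?_)) ?_
  · have := card_filter_fin_val (n := n + 1) (fun x => x < (c : ℕ) ∧ x < w (Fin.last n))
    simp only [Fin.lt_def]
    rw [this]
    have : (Finset.range (n + 1)).filter (fun x => x < (c : ℕ) ∧ x < w (Fin.last n)) =
        Finset.range c := by
      ext x
      simp only [Finset.mem_filter, Finset.mem_range]
      omega
    rw [this, Finset.card_range]
  · have := card_filter_fin_val (n := n + 1) (fun x => (c : ℕ) < x ∧ x < w (Fin.last n))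
    simp only [Fin.lt_def]
    rw [this]
    have : (Finset.range (n + 1)).filter (fun x => (c : ℕ) < x ∧ x < w (Fin.last n)) =
        Finset.Ico ((c : ℕ) + 1) (w (Fin.last n)) := by
      ext x
      simp only [Finset.mem_filter, Finset.mem_range, Finset.mem_Ico]
      omega
    rw [this, Nat.card_Ico]
    omega
  · refine forall_congr' fun v => ?_
    have hv : (c : ℕ) < w v.castSucc := hc.trans_le (hw (Fin.le_last _))
    rw [insertLast_castSucc, succAbove_lt_iff_lt_pred c _ _ hv,
      card_filter_castSucc v _ (fun u => τ u < τ v ∧ (τ u : ℕ) < w v.castSucc - 1),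
      card_filter_castSucc v _ (fun u => τ v < τ u ∧ (τ u : ℕ) < w v.castSucc - 1)]
    all_goals
      intro u
      rw [insertLast_castSucc, succAbove_lt_iff_lt_pred c _ _ hv, Fin.succAbove_lt_succAbove_iff]

theorem card_range_bounded (W a b : ℕ) :
    ((Finset.range W).filter fun c => ¬(a ≤ c ∧ c + b < W)).card = min W (a + b) := by
  have : (Finset.range W).filter (fun c => ¬(a ≤ c ∧ c + b < W)) =
      Finset.range W \ Finset.Ico a (W - b) := by
    ext x
    simp only [Finset.mem_filter, Finset.mem_range, Finset.mem_sdiff, Finset.mem_Ico]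
    omega
  rw [this, Finset.card_sdiff_of_subset, Finset.card_range, Nat.card_Ico]
  · omega
  · intro x
    simp only [Finset.mem_range, Finset.mem_Ico]
    omega

theorem card_isBounded {n : ℕ} (w : Fin n → ℕ) (hw : Antitone w) (hn : ∀ v, w v ≤ n) (a b : ℕ) :
    Nat.card {τ : Equiv.Perm (Fin n) // IsBounded w a b τ} =
      ∏ v : Fin n, min (w v + v + 1 - n) (a + b) := by
  induction n with
  | zero =>
    have : ∀ τ, IsBounded w a b τ := fun τ v => v.elim0
    simp [this]
  | succ n ih =>
    have hW := hn (Fin.last n)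
    rw [← Nat.card_congr (Equiv.subtypeEquiv (Equiv.ofBijective _ (insertLast_bijective n))
      (p := fun p => ((p.1 : ℕ) < w (Fin.last n) ∧ ¬(a ≤ p.1 ∧ p.1 + b < w (Fin.last n))) ∧
        IsBounded (fun u => w u.castSucc - 1) a b p.2)
      fun p => (isBounded_insertLast hw hn a b p.1 p.2).symm),
      Nat.card_congr (Equiv.subtypeProdEquivProd
        (p := fun c : Fin (n + 1) =>
          (c : ℕ) < w (Fin.last n) ∧ ¬(a ≤ (c : ℕ) ∧ (c : ℕ) + b < w (Fin.last n)))
        (q := fun τ : Equiv.Perm (Fin n) => IsBounded (fun u => w u.castSucc - 1) a b τ)),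
      Nat.card_prod, Fin.prod_univ_castSucc, mul_comm,
      ih (fun u => w u.castSucc - 1) (fun u v huv => Nat.sub_le_sub_right (hw huv) 1)
        (fun v => by have := hn v.castSucc; omega)]
    congr 1
    · refine Finset.prod_congr rfl fun v _ => ?_
      congr 1
      simp only [Fin.val_castSucc]
      omega
    · rw [Nat.card_eq_fintype_card, Fintype.card_subtype,
        card_filter_fin_val
          (fun c => c < w (Fin.last n) ∧ ¬(a ≤ c ∧ c + b < w (Fin.last n))),
        show w (Fin.last n) + (Fin.last n : ℕ) + 1 - (n + 1) = w (Fin.last n) by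
          simp only [Fin.val_last]; omega, ← card_range_bounded]
      congr 1
      ext x
      simp only [Finset.mem_filter, Finset.mem_range]
      omega

/-- The shape multisets of a board and of its transpose coincide. -/
theorem prod_shape_transpose {n : ℕ} (R : Fin n → Fin n → Prop) [∀ i j, Decidable (R i j)]
    (w h : Fin n → ℕ) (hw : ∀ i j, R i j ↔ (j : ℕ) < w i) (hh : ∀ i j, R i j ↔ (i : ℕ) < h j)
    (hwn : ∀ i, w i ≤ n) (hhn : ∀ j, h j ≤ n) (φ : ℕ → ℕ) :
    ∏ i, φ (w i + i) = ∏ j, φ (h j + j) := by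
  have sum_row : ∀ (f : ℕ → ℤ) (i : ℕ) (m : ℕ), m ≤ n →
      f (m + i) - f i = ∑ j : Fin n, if (j : ℕ) < m then f (i + j + 1) - f (i + j) else 0 := by
    intro f i m hm
    rw [Fin.sum_univ_eq_sum_range (fun j => if j < m then f (i + j + 1) - f (i + j) else 0) n,
      ← Finset.sum_filter]
    have : (Finset.range n).filter (fun j => j < m) = Finset.range m := by
      ext x
      simp only [Finset.mem_filter, Finset.mem_range]
      omega
    rw [this, add_comm m i]
    exact (Finset.sum_range_sub (fun j => f (i + j)) m).symm
  have sum_eq : ∀ f : ℕ → ℤ, ∑ i, f (w i + i) = ∑ j, f (h j + j) := by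
    intro f
    have : ∑ i, (f (w i + i) - f i) = ∑ j, (f (h j + j) - f j) := by
      simp_rw [fun i : Fin n => sum_row f i (w i) (hwn i),
        fun j : Fin n => sum_row f j (h j) (hhn j), ← hw, ← hh]
      rw [Finset.sum_comm]
      simp only [add_comm]
    simpa [Finset.sum_sub_distrib] using this
  have hm : Finset.univ.val.map (fun i : Fin n => w i + i) =
      Finset.univ.val.map (fun j : Fin n => h j + j) := by
    ext x
    have := sum_eq (fun y => if x = y then 1 else 0)
    simp only [Finset.sum_boole, Nat.cast_inj] at this
    rw [Multiset.count_map, Multiset.count_map]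
    exact this
  have := congrArg (fun s => (s.map φ).prod) hm
  simpa [Finset.prod, Multiset.map_map, Function.comp_def] using this

theorem exists_strictMono_iff {n k : ℕ} (t : Fin k) (c : Fin n) (P : Fin n → Prop)
    [DecidablePred P] :
    (∃ f : Fin k → Fin n, StrictMono f ∧ f t = c ∧ ∀ a, a ≠ t → P (f a)) ↔
      (t : ℕ) ≤ (Finset.univ.filter fun x => x < c ∧ P x).card ∧
        k - 1 - t ≤ (Finset.univ.filter fun x => c < x ∧ P x).card := by
  constructor
  · rintro ⟨f, hf, rfl, hP⟩
    constructor
    · rw [← Fin.card_Iio t, ← Finset.card_image_of_injective _ hf.injective]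
      refine Finset.card_le_card fun x hx => ?_
      obtain ⟨a, ha, rfl⟩ := Finset.mem_image.1 hx
      have ha := Finset.mem_Iio.1 ha
      simpa using ⟨hf ha, hP a ha.ne⟩
    · rw [← Fin.card_Ioi t, ← Finset.card_image_of_injective _ hf.injective]
      refine Finset.card_le_card fun x hx => ?_
      obtain ⟨a, ha, rfl⟩ := Finset.mem_image.1 hx
      have ha := Finset.mem_Ioi.1 ha
      simpa using ⟨hf ha, hP a ha.ne'⟩
  · rintro ⟨hl, hr⟩
    obtain ⟨L, hL, hLc⟩ := Finset.exists_subset_card_eq hl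
    obtain ⟨R, hR, hRc⟩ := Finset.exists_subset_card_eq hr
    have hL' : ∀ i, L.orderEmbOfFin hLc i < c ∧ P (L.orderEmbOfFin hLc i) := fun i => by
      simpa using hL (L.orderEmbOfFin_mem hLc i)
    have hR' : ∀ i, c < R.orderEmbOfFin hRc i ∧ P (R.orderEmbOfFin hRc i) := fun i => by
      simpa using hR (R.orderEmbOfFin_mem hRc i)
    let f : Fin k → Fin n := fun a =>
      if h : a < t then L.orderEmbOfFin hLc ⟨a, h⟩
      else if h' : t < a then
        R.orderEmbOfFin hRc ⟨a - t - 1, by have := a.isLt; rw [Fin.lt_def] at h'; omega⟩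
      else c
    have f_lt : ∀ a (h : a < t), f a = L.orderEmbOfFin hLc ⟨a, h⟩ := fun a h => dif_pos h
    have f_gt : ∀ a (h : t < a), f a = R.orderEmbOfFin hRc
        ⟨a - t - 1, by have := a.isLt; rw [Fin.lt_def] at h; omega⟩ := fun a h => by
      simp only [f]
      rw [dif_neg h.not_gt, dif_pos h]
    have f_eq : f t = c := by simp [f]
    refine ⟨f, fun a b hab => ?_, f_eq, fun a ha => ?_⟩
    · rcases lt_trichotomy b t with hb | rfl | hb
      · rw [f_lt a (hab.trans hb), f_lt b hb]
        simpa using hab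
      · rw [f_lt a hab, f_eq]
        exact (hL' _).1
      · rcases lt_trichotomy a t with ha | rfl | ha
        · rw [f_lt a ha, f_gt b hb]
          exact (hL' _).1.trans (hR' _).1
        · rw [f_gt b hb, f_eq]
          exact (hR' _).1
        · rw [f_gt a ha, f_gt b hb]
          simp only [OrderEmbedding.lt_iff_lt, Fin.lt_def] at ha hb hab ⊢
          omega
    · rcases lt_or_gt_of_ne ha with ha | ha
      · rw [f_lt a ha]
        exact (hL' _).2
      · rw [f_gt a ha]
        exact (hR' _).2

theorem exists_perm_orderIso {k : ℕ} {α : Type*} [LinearOrder α] (g : Fin k → α)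
    (hg : Function.Injective g) : ∃ p : Equiv.Perm (Fin k), ∀ a b, g a < g b ↔ p a < p b := by
  have hc : (Finset.univ.image g).card = k := by
    rw [Finset.card_image_of_injective _ hg, Finset.card_fin]
  let e := (Finset.univ.image g).orderIsoOfFin hc
  have hmem : ∀ a, g a ∈ Finset.univ.image g := fun a => Finset.mem_image_of_mem _ (by simp)
  have hinj : Function.Injective fun a => e.symm ⟨g a, hmem a⟩ := fun a b h =>
    hg (by simpa using h)
  refine ⟨Equiv.ofBijective _ (Finite.injective_iff_bijective.1 hinj), fun a b => ?_⟩
  simp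

theorem fillingAvoidsSet_Aset_iff {n k : ℕ} (t : Fin k) (F : FerrersBoard n)
    (σ : Equiv.Perm (Fin n)) (hσ : IsFilling F σ) :
    FillingAvoidsSet F σ (Aset k t) ↔ ∀ c, ¬∃ f : Fin k → Fin n, StrictMono f ∧ f t = c ∧
      ∀ a, a ≠ t → σ (f a) < σ c ∧ (f a, σ c) ∈ F.cells := by
  constructor
  · rintro h c ⟨f, hf, rfl, hP⟩
    obtain ⟨p, hp⟩ := exists_perm_orderIso (fun a => σ (f a)) (σ.injective.comp hf.injective)
    have hle : ∀ a, σ (f a) ≤ σ (f t) := fun a => by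
      rcases eq_or_ne a t with rfl | ha
      · exact le_rfl
      · exact (hP a ha).1.le
    refine h ⟨k, p⟩ ⟨p, fun a => ?_, rfl⟩ ⟨f, hf, hp, fun a b => ?_⟩
    · rw [← not_lt, ← hp, not_lt]
      exact hle a
    · refine F.downward_closed (?_ : (f a, σ (f t)) ∈ F.cells) le_rfl (hle b)
      rcases eq_or_ne a t with rfl | ha
      · exact hσ _
      · exact (hP a ha).2
  · rintro h _ ⟨p, hp, rfl⟩ ⟨f, hf, hord, hF⟩
    refine h (f t) ⟨f, hf, rfl, fun a ha => ⟨?_, hF a t⟩⟩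
    exact (hord a t).2 (lt_of_le_of_ne (hp a) fun e => ha (p.injective e))

theorem fillingAvoidsSet_Bset_iff {n k : ℕ} (hk : 1 ≤ k) (F : FerrersBoard n)
    (σ : Equiv.Perm (Fin n)) (hσ : IsFilling F σ) :
    FillingAvoidsSet F σ (Bset k hk) ↔ ∀ c, ¬∃ f : Fin k → Fin n, StrictMono f ∧
      f ⟨k - 1, Nat.sub_lt hk Nat.one_pos⟩ = c ∧
      ∀ a, a ≠ ⟨k - 1, Nat.sub_lt hk Nat.one_pos⟩ → σ c < σ (f a) ∧ (c, σ (f a)) ∈ F.cells := by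
  set t : Fin k := ⟨k - 1, Nat.sub_lt hk Nat.one_pos⟩
  constructor
  · rintro h c ⟨f, hf, rfl, hP⟩
    obtain ⟨p, hp⟩ := exists_perm_orderIso (fun a => σ (f a)) (σ.injective.comp hf.injective)
    refine h ⟨k, p⟩ ⟨p, fun a => ?_, rfl⟩ ⟨f, hf, hp, fun a b => ?_⟩
    · rw [← not_lt, ← hp, not_lt]
      rcases eq_or_ne a t with rfl | ha
      · exact le_rfl
      · exact (hP a ha).1.le
    · have hat : a ≤ t := by
        rw [Fin.le_def]
        exact Nat.le_sub_one_of_lt a.isLt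
      refine F.downward_closed (?_ : (f t, σ (f b)) ∈ F.cells) (hf.monotone hat) le_rfl
      rcases eq_or_ne b t with rfl | hb
      · exact hσ _
      · exact (hP b hb).2
  · rintro h _ ⟨p, hp, rfl⟩ ⟨f, hf, hord, hF⟩
    refine h (f t) ⟨f, hf, rfl, fun a ha => ⟨?_, hF t a⟩⟩
    exact (hord t a).2 (lt_of_le_of_ne (hp a) fun e => ha (p.injective e.symm))

/-- A downward-closed predicate on `Fin n` holds exactly on an initial segment. -/
theorem iff_lt_card_filter {n : ℕ} (p : Fin n → Prop) [DecidablePred p]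
    (hp : ∀ ⦃i j⦄, i ≤ j → p j → p i) (i : Fin n) :
    p i ↔ (i : ℕ) < (Finset.univ.filter p).card := by
  constructor
  · intro h
    rw [← Nat.succ_le_iff, Nat.succ_eq_add_one, ← Fin.card_Iic]
    exact Finset.card_le_card fun j hj => by simpa using hp (Finset.mem_Iic.1 hj) h
  · intro h
    by_contra hi
    have : (Finset.univ.filter p).card ≤ (Finset.Iio i).card :=
      Finset.card_le_card fun j hj => Finset.mem_Iio.2 <| not_le.1 fun hij =>
        hi (hp hij (Finset.mem_filter.1 hj).2)
    rw [Fin.card_Iio] at this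
    omega

open Classical in
/-- The number of cells of `F` in row `v`. -/
noncomputable def rowLength {n : ℕ} (F : FerrersBoard n) (v : Fin n) : ℕ :=
  (Finset.univ.filter fun c => (c, v) ∈ F.cells).card

open Classical in
/-- The number of cells of `F` in column `c`. -/
noncomputable def colLength {n : ℕ} (F : FerrersBoard n) (c : Fin n) : ℕ :=
  (Finset.univ.filter fun v => (c, v) ∈ F.cells).card

theorem mem_cells_iff_lt_rowLength {n : ℕ} (F : FerrersBoard n) (c v : Fin n) :
    (c, v) ∈ F.cells ↔ (c : ℕ) < rowLength F v := by
  classical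
  exact iff_lt_card_filter (fun c => (c, v) ∈ F.cells)
    (fun _ _ h hj => F.downward_closed hj h le_rfl) c

theorem mem_cells_iff_lt_colLength {n : ℕ} (F : FerrersBoard n) (c v : Fin n) :
    (c, v) ∈ F.cells ↔ (v : ℕ) < colLength F c := by
  classical
  exact iff_lt_card_filter (fun v => (c, v) ∈ F.cells)
    (fun _ _ h hj => F.downward_closed hj le_rfl h) v

theorem rowLength_le {n : ℕ} (F : FerrersBoard n) (v : Fin n) : rowLength F v ≤ n :=
  (Finset.card_le_univ _).trans_eq (Fintype.card_fin n)

theorem colLength_le {n : ℕ} (F : FerrersBoard n) (c : Fin n) : colLength F c ≤ n :=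
  (Finset.card_le_univ _).trans_eq (Fintype.card_fin n)

theorem rowLength_antitone {n : ℕ} (F : FerrersBoard n) : Antitone (rowLength F) := by
  classical
  exact fun u v huv => Finset.card_le_card fun c hc => Finset.mem_filter.2
    ⟨Finset.mem_univ _, F.downward_closed (Finset.mem_filter.1 hc).2 le_rfl huv⟩

theorem colLength_antitone {n : ℕ} (F : FerrersBoard n) : Antitone (colLength F) := by
  classical
  exact fun u v huv => Finset.card_le_card fun c hc => Finset.mem_filter.2
    ⟨Finset.mem_univ _, F.downward_closed (Finset.mem_filter.1 hc).2 huv le_rfl⟩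

theorem isFilling_and_avoids_Aset_iff {n k : ℕ} (t : Fin k) (F : FerrersBoard n)
    (σ : Equiv.Perm (Fin n)) :
    IsFilling F σ ∧ FillingAvoidsSet F σ (Aset k t) ↔
      IsBounded (rowLength F) t (k - 1 - t) σ.symm := by
  have hfill : IsFilling F σ ↔ ∀ v, (σ.symm v : ℕ) < rowLength F v := by
    rw [← σ.forall_congr_right]
    simp only [IsFilling, mem_cells_iff_lt_rowLength, Equiv.symm_apply_apply]
  rw [IsBounded, forall_and, ← hfill]
  refine and_congr_right fun hσ => ?_
  rw [fillingAvoidsSet_Aset_iff t F σ hσ]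
  refine σ.forall_congr fun c => not_congr ?_
  simp only [mem_cells_iff_lt_rowLength]
  rw [exists_strictMono_iff t c (fun x => σ x < σ c ∧ (x : ℕ) < rowLength F (σ c)),
    ← card_filter_map_perm σ (fun u => u < σ c ∧ _),
    ← card_filter_map_perm σ (fun u => u < σ c ∧ _)]
  simp only [Equiv.symm_apply_apply, and_left_comm]

theorem isFilling_and_avoids_Bset_iff {n k : ℕ} (hk : 1 ≤ k) (F : FerrersBoard n)
    (σ : Equiv.Perm (Fin n)) :
    IsFilling F σ ∧ FillingAvoidsSet F σ (Bset k hk) ↔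
      IsBounded (colLength F) 0 (k - 1) σ := by
  have hfill : IsFilling F σ ↔ ∀ c, (σ c : ℕ) < colLength F c := by
    simp only [IsFilling, mem_cells_iff_lt_colLength]
  rw [IsBounded, forall_and, ← hfill]
  refine and_congr_right fun hσ => ?_
  rw [fillingAvoidsSet_Bset_iff hk F σ hσ]
  refine forall_congr' fun c => not_congr ?_
  simp only [mem_cells_iff_lt_colLength]
  rw [exists_strictMono_iff _ c (fun x => σ c < σ x ∧ (σ x : ℕ) < colLength F c)]
  simp

/-- For every `k ≥ 1` and every position `t` in `{1, …, k}`, the pattern sets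
`A_{k,t}` and `B_k` are shape-Wilf-equivalent. -/
theorem stmt5 (k : ℕ) (hk : 1 ≤ k) (t : Fin k) :
    ShapeWilfEquiv (Aset k t) (Bset k hk) := by
  classical
  intro n _ F
  rw [Nat.card_congr (Equiv.subtypeEquiv (Equiv.inv (Equiv.Perm (Fin n)))
      fun σ => isFilling_and_avoids_Aset_iff t F σ),
    Nat.card_congr (Equiv.subtypeEquivRight fun σ => isFilling_and_avoids_Bset_iff hk F σ),
    card_isBounded _ (rowLength_antitone F) (rowLength_le F),
    card_isBounded _ (colLength_antitone F) (colLength_le F)]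
  have ht : (t : ℕ) + (k - 1 - t) = 0 + (k - 1) := by
    have := t.isLt
    omega
  rw [ht]
  exact prod_shape_transpose (fun v c => (c, v) ∈ F.cells) (rowLength F) (colLength F)
    (fun v c => mem_cells_iff_lt_rowLength F c v) (fun v c => mem_cells_iff_lt_colLength F c v)
    (rowLength_le F) (colLength_le F) (fun x => min (x + 1 - n) (0 + (k - 1)))
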